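/- Let C be the Cartan matrix of type E₇ and C̃ the affine Cartan matrix of type E₇^{(1)} (size 8). Define simple reflections by s_i(e_j) = e_j − c_{ij} e_i in the respective standard bases, let c be the product of the 7 simple reflections of C (any fixed order) and c_a the product of the 8 simple reflections of C̃ (any fixed order). Then det(t·I − c)·(1−t)(1−t⁶)(1−t⁹) = (1−t²)(1−t³)(1−t^{18}), det(t·I − c_a)·(1−t) = (1−t²)(1−t³)(1−t⁴), and consequently the Poincaré series p(t) = (1−t^{18})/((1−t⁴)(1−t⁶)(1−t⁹)) of the Kleinian singularity of type E₇ satisfies p(t) = det(t·I − c)/det(t·I − c_a) as rational functions. -/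

import Mathlib

open Polynomial

/-- The simple reflection `s_i` associated to a (generalized) Cartan matrix `C`,
acting on the standard basis by `s_i(e_j) = e_j - c_{ij} e_i`. -/
def simpleRefl {N : ℕ} (C : Matrix (Fin N) (Fin N) ℚ) (i : Fin N) :
    Matrix (Fin N) (Fin N) ℚ :=
  Matrix.of fun k j => (if k = j then 1 else 0) - (if k = i then C i j else 0)

/-- The Cartan matrix of type `E₇` over `ℚ`. -/
def cartanE7 : Matrix (Fin 7) (Fin 7) ℚ :=
  (CartanMatrix.E₇).map fun x => (x : ℚ)

/-- The affine Cartan matrix of type `E₇⁽¹⁾` (size 8): the `E₇` diagram with an extra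
vertex (index 7) attached to the end (index 0) of the long arm. -/
def cartanE7Affine : Matrix (Fin 8) (Fin 8) ℚ :=
  !![2, 0, -1, 0, 0, 0, 0, -1;
     0, 2, 0, -1, 0, 0, 0, 0;
     -1, 0, 2, -1, 0, 0, 0, 0;
     0, -1, -1, 2, -1, 0, 0, 0;
     0, 0, 0, -1, 2, -1, 0, 0;
     0, 0, 0, 0, -1, 2, -1, 0;
     0, 0, 0, 0, 0, -1, 2, 0;
     -1, 0, 0, 0, 0, 0, 0, 2]

section

variable {N : ℕ} {C : Matrix (Fin N) (Fin N) ℚ}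

theorem simpleRefl_mul_apply (i k j : Fin N) (A : Matrix (Fin N) (Fin N) ℚ) :
    (simpleRefl C i * A) k j = A k j - if k = i then ∑ m, C i m * A m j else 0 := by
  simp only [simpleRefl, Matrix.mul_apply, Matrix.of_apply, sub_mul, Finset.sum_sub_distrib]
  congr 1
  · simp
  · split_ifs <;> simp

theorem prod_simpleRefl_apply_of_notMem {l : List (Fin N)} {k : Fin N} (hk : k ∉ l)
    (j : Fin N) : (l.map (simpleRefl C)).prod k j = (1 : Matrix (Fin N) (Fin N) ℚ) k j := by
  induction l with
  | nil => rfl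
  | cons a l ih =>
    rw [List.mem_cons, not_or] at hk
    rw [List.map_cons, List.prod_cons, simpleRefl_mul_apply, if_neg hk.1, sub_zero, ih hk.2]

/-- The rows of a product of simple reflections, taken in the order given by `p`. -/
theorem prod_simpleRefl_apply {ι : Type*} [LinearOrder ι] (p : Fin N → ι) {l : List (Fin N)}
    (hl : l.Pairwise fun a b => p a < p b) {i : Fin N} (hi : i ∈ l) (j : Fin N) :
    (l.map (simpleRefl C)).prod i j = (1 : Matrix (Fin N) (Fin N) ℚ) i j -
      ∑ m, C i m * if m ∈ l ∧ p i < p m then (l.map (simpleRefl C)).prod m j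
        else (1 : Matrix (Fin N) (Fin N) ℚ) m j := by
  induction l with
  | nil => simp at hi
  | cons a l ih =>
    rw [List.pairwise_cons] at hl
    have ha : a ∉ l := fun h => lt_irrefl _ (hl.1 a h)
    have key : ∀ m ∈ l, ((a :: l).map (simpleRefl C)).prod m j =
        (l.map (simpleRefl C)).prod m j := fun m hm => by
      rw [List.map_cons, List.prod_cons, simpleRefl_mul_apply,
        if_neg (ne_of_mem_of_not_mem hm ha), sub_zero]
    rcases List.mem_cons.1 hi with rfl | hil
    · rw [List.map_cons, List.prod_cons, simpleRefl_mul_apply, if_pos rfl,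
        prod_simpleRefl_apply_of_notMem ha, ← List.prod_cons, ← List.map_cons]
      congr 1
      refine Finset.sum_congr rfl fun m _ => ?_
      by_cases hm : m ∈ l
      · rw [if_pos ⟨List.mem_cons_of_mem _ hm, hl.1 m hm⟩, key m hm]
      · rw [prod_simpleRefl_apply_of_notMem hm, if_neg]
        rintro ⟨h, hlt⟩
        rcases List.mem_cons.1 h with rfl | h
        · exact lt_irrefl _ hlt
        · exact hm h
    · rw [key i hil, ih hl.2 hil]
      congr 1
      refine Finset.sum_congr rfl fun m _ => ?_
      by_cases hm : m ∈ l ∧ p i < p m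
      · rw [if_pos hm, if_pos ⟨List.mem_cons_of_mem _ hm.1, hm.2⟩, key m hm.1]
      · rw [if_neg hm, if_neg]
        rintro ⟨h, hlt⟩
        rcases List.mem_cons.1 h with rfl | h
        · exact lt_asymm hlt (hl.1 i hil)
        · exact hm ⟨h, hlt⟩

/-- The characteristic polynomial of a Coxeter element is the determinant of the polarization of
the Cartan matrix given by the order of the factors. -/
theorem charpoly_prod_simpleRefl (hC : ∀ i, C i i = 2) (σ : Equiv.Perm (Fin N)) :
    (List.ofFn fun k => simpleRefl C (σ k)).prod.charpoly =
      (Matrix.of fun i j => if i = j then X + 1 else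
        Polynomial.C (C i j) * if σ.symm i < σ.symm j then X else 1).det := by
  set c := (List.ofFn fun k => simpleRefl C (σ k)).prod with hc
  have hmap : c = ((List.ofFn σ).map (simpleRefl C)).prod := by
    rw [hc, List.map_ofFn]; rfl
  have hrow (i j : Fin N) : c i j = (1 : Matrix (Fin N) (Fin N) ℚ) i j -
      ∑ m, C i m * if σ.symm i < σ.symm m then c m j
        else (1 : Matrix (Fin N) (Fin N) ℚ) m j := by
    have hmem (m : Fin N) : m ∈ List.ofFn σ :=
      List.mem_ofFn.2 (σ.surjective m)
    have := prod_simpleRefl_apply (C := C) σ.symm (l := List.ofFn σ)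
      (by simp [List.pairwise_ofFn]) (hmem i) j
    simpa only [← hmap, hmem, true_and] using this
  let U : Matrix (Fin N) (Fin N) ℚ[X] := Matrix.of fun i j =>
    (1 : Matrix (Fin N) (Fin N) ℚ[X]) i j +
      if σ.symm i < σ.symm j then Polynomial.C (C i j) else 0
  have hU : U.det = 1 := by
    rw [← Matrix.det_submatrix_equiv_self σ, Matrix.det_of_isUpperTriangular]
    · simp [U]
    · intro i j hij
      have hij : j < i := hij
      simp [U, Matrix.one_apply, hij.ne', hij.not_gt]
  trans U.det * c.charpoly
  · rw [hU, one_mul]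
  rw [Matrix.charpoly, ← Matrix.det_mul]
  congr 1
  ext1 i j
  have hsum : (U * Polynomial.C.mapMatrix c) i j = Polynomial.C (c i j +
      ∑ m, if σ.symm i < σ.symm m then C i m * c m j else 0) := by
    simp [U, Matrix.mul_apply, Matrix.one_apply, add_mul, Finset.sum_add_distrib, map_sum,
      apply_ite Polynomial.C]
  have hval : c i j + ∑ m, (if σ.symm i < σ.symm m then C i m * c m j else 0) =
      (1 : Matrix (Fin N) (Fin N) ℚ) i j - if σ.symm i < σ.symm j then 0 else C i j := by
    rw [hrow i j, sub_add, ← Finset.sum_sub_distrib]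
    congr 1
    rw [Finset.sum_eq_single j]
    · by_cases h : σ.symm i < σ.symm j <;> simp [h]
    · intro m _ hm
      by_cases h : σ.symm i < σ.symm m <;> simp [h, hm]
    · simp
  rw [Matrix.charmatrix, mul_sub, Matrix.sub_apply, hsum, hval]
  rcases eq_or_ne i j with rfl | hij
  · simp [U, Matrix.scalar_apply, hC, Polynomial.C_ofNat]
    ring
  · by_cases h : σ.symm i < σ.symm j <;> simp [U, Matrix.scalar_apply, hij, h]

end

/-- The determinant of a weighted tree of shape `E₇`. -/
theorem det_tree_E7 {R : Type*} [CommRing R] {x t : R} {w : Fin 7 → Fin 7 → R}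
    (hw : ∀ i j, i ≠ j → w i j * w j i = t) :
    (!![x, 0, w 0 2, 0, 0, 0, 0;
        0, x, 0, w 1 3, 0, 0, 0;
        w 2 0, 0, x, w 2 3, 0, 0, 0;
        0, w 3 1, w 3 2, x, w 3 4, 0, 0;
        0, 0, 0, w 4 3, x, w 4 5, 0;
        0, 0, 0, 0, w 5 4, x, w 5 6;
        0, 0, 0, 0, 0, w 6 5, x] :
      Matrix (Fin 7) (Fin 7) R).det =
      (x * (x ^ 2 - t) - t * x) * (x ^ 3 - (t + t) * x) * x
      - t * (x ^ 2 - t) * (x ^ 3 - (t + t) * x)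
      - t * (x ^ 2 - t) * (x ^ 2 - t) * x := by
  trans (x * (x ^ 2 - w 0 2 * w 2 0) - w 2 3 * w 3 2 * x) * (x ^ 3 - (w 4 5 * w 5 4 + w 5 6 * w 6 5) * x) * x
      - w 1 3 * w 3 1 * (x ^ 2 - w 0 2 * w 2 0) * (x ^ 3 - (w 4 5 * w 5 4 + w 5 6 * w 6 5) * x)
      - w 3 4 * w 4 3 * (x ^ 2 - w 0 2 * w 2 0) * (x ^ 2 - w 5 6 * w 6 5) * x
  · simp [Matrix.det_succ_row_zero, Fin.sum_univ_succ, Fin.succAbove]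
    ring
  · rw [hw 0 2 (by decide), hw 1 3 (by decide), hw 2 3 (by decide),
      hw 3 4 (by decide), hw 4 5 (by decide), hw 5 6 (by decide)]

set_option maxHeartbeats 2000000 in
/-- The determinant of a weighted tree of shape `E₇⁽¹⁾`. -/
theorem det_tree_E7Affine {R : Type*} [CommRing R] {x t : R} {w : Fin 8 → Fin 8 → R}
    (hw : ∀ i j, i ≠ j → w i j * w j i = t) :
    (!![x, 0, w 0 2, 0, 0, 0, 0, w 0 7;
        0, x, 0, w 1 3, 0, 0, 0, 0;
        w 2 0, 0, x, w 2 3, 0, 0, 0, 0;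
        0, w 3 1, w 3 2, x, w 3 4, 0, 0, 0;
        0, 0, 0, w 4 3, x, w 4 5, 0, 0;
        0, 0, 0, 0, w 5 4, x, w 5 6, 0;
        0, 0, 0, 0, 0, w 6 5, x, 0;
        w 7 0, 0, 0, 0, 0, 0, 0, x] :
      Matrix (Fin 8) (Fin 8) R).det =
      x * (x ^ 3 - (t + t) * x) *
       (x ^ 3 - (t + t) * x) * x
      - t * (x ^ 3 - (t + t) * x) *
       (x ^ 3 - (t + t) * x)
      - t * (x ^ 2 - t) * (x ^ 3 - (t + t) * x) * x
      - t * (x ^ 3 - (t + t) * x) * (x ^ 2 - t) * x := by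
  trans x * (x ^ 3 - (w 0 2 * w 2 0 + w 0 7 * w 7 0) * x) *
       (x ^ 3 - (w 4 5 * w 5 4 + w 5 6 * w 6 5) * x) * x
      - w 1 3 * w 3 1 * (x ^ 3 - (w 0 2 * w 2 0 + w 0 7 * w 7 0) * x) *
       (x ^ 3 - (w 4 5 * w 5 4 + w 5 6 * w 6 5) * x)
      - w 2 3 * w 3 2 * (x ^ 2 - w 0 7 * w 7 0) * (x ^ 3 - (w 4 5 * w 5 4 + w 5 6 * w 6 5) * x) * x
      - w 3 4 * w 4 3 * (x ^ 3 - (w 0 2 * w 2 0 + w 0 7 * w 7 0) * x) * (x ^ 2 - w 5 6 * w 6 5) * x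
  · simp [Matrix.det_succ_row_zero, Fin.sum_univ_succ, Fin.succAbove]
    ring
  · rw [hw 0 2 (by decide), hw 1 3 (by decide), hw 2 3 (by decide),
      hw 3 4 (by decide), hw 4 5 (by decide), hw 5 6 (by decide), hw 0 7 (by decide)]

theorem polarization_mul_swap {ι : Type*} [LinearOrder ι] {i j : ι} (h : i ≠ j) :
    (Polynomial.C (-1 : ℚ) * if i < j then X else 1) *
      (Polynomial.C (-1) * if j < i then X else 1) = X := by
  rcases h.lt_or_gt with h | h <;> simp [h, h.not_gt]

theorem charpoly_coxeter_E7 (σ : Equiv.Perm (Fin 7)) :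
    (List.ofFn fun k => simpleRefl cartanE7 (σ k)).prod.charpoly =
      (1 + X) * (1 - X ^ 3 + X ^ 6) := by
  rw [charpoly_prod_simpleRefl
    (fun i => by fin_cases i <;> simp [cartanE7, CartanMatrix.E₇])]
  convert det_tree_E7 (R := ℚ[X]) (x := X + 1) (t := X)
    (w := fun i j => Polynomial.C (-1 : ℚ) * if σ.symm i < σ.symm j then X else 1)
    (fun i j h => polarization_mul_swap (σ.symm.injective.ne h)) using 1
  · congr 1
    ext1 i j
    fin_cases i <;> fin_cases j <;> simp [cartanE7, CartanMatrix.E₇]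
  · ring

theorem charpoly_coxeter_E7Affine (τ : Equiv.Perm (Fin 8)) :
    (List.ofFn fun k => simpleRefl cartanE7Affine (τ k)).prod.charpoly =
      (1 + X) * (1 - X ^ 3) * (1 - X ^ 4) := by
  rw [charpoly_prod_simpleRefl (fun i => by fin_cases i <;> simp [cartanE7Affine])]
  convert det_tree_E7Affine (R := ℚ[X]) (x := X + 1) (t := X)
    (w := fun i j => Polynomial.C (-1 : ℚ) * if τ.symm i < τ.symm j then X else 1)
    (fun i j h => polarization_mul_swap (τ.symm.injective.ne h)) using 1
  · congr 1
    ext1 i j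
    fin_cases i <;> fin_cases j <;> simp [cartanE7Affine]
  · ring

theorem ratFunc_one_sub_X_pow_ne_zero {K : Type*} [Field K] {n : ℕ} (hn : n ≠ 0) :
    (1 - RatFunc.X ^ n : RatFunc K) ≠ 0 := by
  have h : (1 - X ^ n : K[X]) ≠ 0 := by
    rw [← neg_ne_zero, neg_sub, ← C_1]
    exact X_pow_sub_C_ne_zero (Nat.pos_of_ne_zero hn) 1
  simpa only [map_sub, map_one, map_pow, RatFunc.algebraMap_X] using
    (map_ne_zero_iff (algebraMap K[X] (RatFunc K)) (RatFunc.algebraMap_injective K)).2 h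

/-- Theorem 2 for type `E₇`: any Coxeter element `c` (product of the 7 simple
reflections of the `E₇` Cartan matrix in any fixed order) and any affine Coxeter
element `c_a` (product of the 8 simple reflections of the affine `E₇⁽¹⁾` Cartan matrix
in any fixed order) satisfy
`det(tI-c)·(1-t)(1-t⁶)(1-t⁹) = (1-t²)(1-t³)(1-t¹⁸)`,
`det(tI-c_a)·(1-t) = (1-t²)(1-t³)(1-t⁴)`, and the Poincaré series
`p(t) = (1-t¹⁸)/((1-t⁴)(1-t⁶)(1-t⁹))` of the Kleinian singularity of type `E₇` equals
`det(tI-c)/det(tI-c_a)` as a rational function. -/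
theorem poincare_series_E7
    (σ : Equiv.Perm (Fin 7)) (τ : Equiv.Perm (Fin 8))
    (c : Matrix (Fin 7) (Fin 7) ℚ)
    (hc : c = (List.ofFn fun k => simpleRefl cartanE7 (σ k)).prod)
    (ca : Matrix (Fin 8) (Fin 8) ℚ)
    (hca : ca = (List.ofFn fun k => simpleRefl cartanE7Affine (τ k)).prod) :
    c.charpoly * ((1 - X) * (1 - X ^ 6) * (1 - X ^ 9))
      = (1 - X ^ 2) * (1 - X ^ 3) * (1 - X ^ 18) ∧
    ca.charpoly * (1 - X) = (1 - X ^ 2) * (1 - X ^ 3) * (1 - X ^ 4) ∧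
    (1 - RatFunc.X ^ 18) /
        ((1 - RatFunc.X ^ 4) * (1 - RatFunc.X ^ 6) * (1 - RatFunc.X ^ 9))
      = algebraMap (Polynomial ℚ) (RatFunc ℚ) c.charpoly /
        algebraMap (Polynomial ℚ) (RatFunc ℚ) ca.charpoly := by
  subst hc hca
  rw [charpoly_coxeter_E7, charpoly_coxeter_E7Affine]
  refine ⟨by ring, by ring, ?_⟩
  have h2 := ratFunc_one_sub_X_pow_ne_zero (K := ℚ) (n := 2) (by decide)
  have h3 := ratFunc_one_sub_X_pow_ne_zero (K := ℚ) (n := 3) (by decide)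
  have h4 := ratFunc_one_sub_X_pow_ne_zero (K := ℚ) (n := 4) (by decide)
  have h6 := ratFunc_one_sub_X_pow_ne_zero (K := ℚ) (n := 6) (by decide)
  have h9 := ratFunc_one_sub_X_pow_ne_zero (K := ℚ) (n := 9) (by decide)
  have h1 : (1 + RatFunc.X : RatFunc ℚ) ≠ 0 := fun h =>
    h2 (by linear_combination (1 - RatFunc.X) * h)
  simp only [map_mul, map_add, map_sub, map_pow, map_one, RatFunc.algebraMap_X]
  rw [div_eq_div_iff (mul_ne_zero (mul_ne_zero h4 h6) h9) (mul_ne_zero (mul_ne_zero h1 h3) h4)]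
  ring
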